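/- Let K be a field of characteristic 2, and let L' be the set of six 3-element subsets {1,2,3}, {1,4,5}, {1,6,7}, {2,4,6}, {2,5,7}, {3,4,7} of {1,…,7}. Then there is no map v from {1,…,7} to K³ such that for every 3-element subset T of {1,…,7}, the family of vectors (v(t))_{t∈T} is linearly dependent over K if and only if T ∈ L'. -/

import Mathlib

/-- The six lines of the non-Fano matroid on the points `{1,…,7}`: all lines of the
Fano plane `PG₂(2)` except `{3,5,6}`. Points are identified with `Fin 7` via
`1 ↦ 0, …, 7 ↦ 6`. -/
def nonFanoLines : Finset (Finset (Fin 7)) :=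
  { {0, 1, 2}, {0, 3, 4}, {0, 5, 6}, {1, 3, 5}, {1, 4, 6}, {2, 3, 6} }

/-- A linear relation among three independent members of a family has zero coefficients. -/
theorem LinearIndepOn.eq_zero_of_triple {ι K V : Type*} [DecidableEq ι] [Ring K] [AddCommGroup V]
    [Module K V] {v : ι → V} {i j k : ι} (h : LinearIndepOn K v ({i, j, k} : Finset ι))
    (hij : i ≠ j) (hik : i ≠ k) (hjk : j ≠ k) {a b c : K}
    (habc : a • v i + b • v j + c • v k = 0) : a = 0 ∧ b = 0 ∧ c = 0 := by
  rw [linearIndepOn_finset_iff] at h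
  have key := h (fun x => if x = i then a else if x = j then b else c) (by
    simpa [Finset.sum_insert, hij, hik, hjk, hij.symm, hik.symm, hjk.symm, ← add_assoc] using habc)
  have hi := key i (by simp)
  have hj := key j (by simp)
  have hk := key k (by simp)
  simp only [hij.symm, hik.symm, hjk.symm, if_true, if_false] at hi hj hk
  exact ⟨hi, hj, hk⟩

/-- In a dependent triple, each vector is a combination of the other two if those two belong to
an independent triple. -/
theorem exists_eq_smul_add_smul_of_not_linearIndepOn {ι K V : Type*} [DecidableEq ι]
    [DivisionRing K] [AddCommGroup V] [Module K V] {v : ι → V} {i j k l : ι}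
    (hl : LinearIndepOn K v ({i, j, l} : Finset ι))
    (hk : ¬ LinearIndepOn K v ({i, j, k} : Finset ι)) :
    ∃ a b : K, v k = a • v i + b • v j := by
  have hij : LinearIndepOn K v {i, j} := hl.mono (by intro x; simp; tauto)
  by_contra! hne
  refine hk ?_
  have hset : (({i, j, k} : Finset ι) : Set ι) = insert k {i, j} := by
    ext x; simp; tauto
  rw [hset]
  refine hij.insert fun hmem => ?_
  rw [Set.image_pair, Submodule.mem_span_pair] at hmem
  obtain ⟨a, b, hab⟩ := hmem
  exact hne a b hab.symm

/-- Non-realizability of the non-Fano matroid over fields of characteristic 2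
("How to draw tropical planes", Section 3): there is no configuration of seven
vectors in `K³` whose dependent triples are exactly the six non-Fano lines. -/
theorem nonFano_not_realizable (K : Type*) [Field K] [CharP K 2] :
    ¬ ∃ v : Fin 7 → (Fin 3 → K),
      ∀ T : Finset (Fin 7), T.card = 3 →
        (¬ LinearIndependent K (fun t : T => v t) ↔ T ∈ nonFanoLines) := by
  rintro ⟨v, hv⟩
  have dep (i j k : Fin 7) (hc : ({i, j, k} : Finset (Fin 7)).card = 3)
      (h : {i, j, k} ∈ nonFanoLines) : ¬ LinearIndepOn K v ({i, j, k} : Finset (Fin 7)) :=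
    (hv _ hc).2 h
  have indep (i j k : Fin 7) (hc : ({i, j, k} : Finset (Fin 7)).card = 3)
      (h : {i, j, k} ∉ nonFanoLines) : LinearIndepOn K v ({i, j, k} : Finset (Fin 7)) :=
    not_not.1 (mt (hv _ hc).1 h)
  have comb (i j k l : Fin 7) (hl : ({i, j, l} : Finset (Fin 7)).card = 3)
      (hl' : {i, j, l} ∉ nonFanoLines) (hk : ({i, j, k} : Finset (Fin 7)).card = 3)
      (hk' : {i, j, k} ∈ nonFanoLines) : ∃ a b : K, v k = a • v i + b • v j :=
    exists_eq_smul_add_smul_of_not_linearIndepOn (indep i j l hl hl') (dep i j k hk hk')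
  obtain ⟨a, b, h2⟩ := comb 0 1 2 3 (by decide) (by decide) (by decide) (by decide)
  obtain ⟨c, d, h4⟩ := comb 0 3 4 1 (by decide) (by decide) (by decide) (by decide)
  obtain ⟨e, f, h5⟩ := comb 1 3 5 0 (by decide) (by decide) (by decide) (by decide)
  obtain ⟨p, q, h605⟩ := comb 0 5 6 1 (by decide) (by decide) (by decide) (by decide)
  obtain ⟨r, s, h614⟩ := comb 1 4 6 0 (by decide) (by decide) (by decide) (by decide)
  obtain ⟨t, u, h623⟩ := comb 2 3 6 0 (by decide) (by decide) (by decide) (by decide)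
  have basis := indep 0 1 3 (by decide) (by decide)
  obtain ⟨hp, -, hf⟩ := basis.eq_zero_of_triple (by decide) (by decide) (by decide)
    (a := p - s * c) (b := q * e - r) (c := q * f - s * d) (by
      have h := h605.symm.trans h614
      rw [h4, h5] at h
      linear_combination (norm := module) h)
  obtain ⟨hp', he, -⟩ := basis.eq_zero_of_triple (by decide) (by decide) (by decide)
    (a := p - t * a) (b := q * e - t * b) (c := q * f - u) (by
      have h := h605.symm.trans h623
      rw [h2, h5] at h
      linear_combination (norm := module) h)
  have ht : t = 0 :=
    ((indep 2 4 5 (by decide) (by decide)).eq_zero_of_triple (by decide) (by decide) (by decide)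
      (a := t) (b := s) (c := q) (by
        have two : (2 : K) = 0 := CharTwo.two_eq_zero
        rw [h2, h4, h5]
        match_scalars
        · linear_combination p * two - hp - hp'
        · linear_combination q * e * two - he
        · linear_combination q * f * two - hf)).1
  have hu := ((indep 0 3 6 (by decide) (by decide)).eq_zero_of_triple (by decide) (by decide)
    (by decide) (a := 0) (b := u) (c := -1) (by rw [h623, ht]; module)).2.2
  exact one_ne_zero (neg_eq_zero.1 hu)
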